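/- Let n ≥ 1 and let α be a chord diagram of order n whose interlacement graph is connected, and suppose g(α, A) = g(α, ∅) for every set A of chords of α. If the distinct chords {x, α x} and {y, α y} do not interlace, then the unordered pair of orbits of ρ ∘ α containing y and α y is different from the unordered pair of orbits containing x and α x; that is, any edge-ribbon not interlaced with a given edge-ribbon e is attached to a pair of face-discs different from the pair attached to e. -/

import Mathlib

open scoped Classical

/-- The first point of `S` among `y + 1, y + 2, …` (equal to `y` if no such point exists). -/
noncomputable def firstAfter (n : ℕ) (S : Set (ZMod (2 * n))) (y : ZMod (2 * n)) : ZMod (2 * n) :=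
  if h : ∃ k : ℕ, 0 < k ∧ y + (k : ZMod (2 * n)) ∈ S then y + (Nat.find h : ZMod (2 * n)) else y

/-- One step of the boundary permutation `π_A` of the endpoint set `S`:
`x ∈ S` goes to the first point of `S` among `α x + 1, α x + 2, …`. -/
def boundaryStep (n : ℕ) (α : Equiv.Perm (ZMod (2 * n))) (S : Set (ZMod (2 * n)))
    (x y : ZMod (2 * n)) : Prop :=
  x ∈ S ∧ y = firstAfter n S (α x)

/-- `c(A)`: the number of orbits of `π_A` on the endpoint set `S`, with `c(∅) = 1`. -/
noncomputable def orbitCount (n : ℕ) (α : Equiv.Perm (ZMod (2 * n))) (S : Set (ZMod (2 * n))) : ℕ :=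
  if S = ∅ then 1
  else ((fun x => {y | Relation.EqvGen (boundaryStep n α S) x y}) '' S).ncard

/-- The genus `g(α, A) = (2 + n − c(A) − c(Aᶜ))/2` of the partial dual relative to the
set of chords with endpoint set `S`. -/
noncomputable def pdGenus (n : ℕ) (α : Equiv.Perm (ZMod (2 * n))) (S : Set (ZMod (2 * n))) : ℕ :=
  (2 + n - orbitCount n α S - orbitCount n α Sᶜ) / 2

/-- The chords `{x, α x}` and `{y, α y}` interlace: writing `α x = x + m`, exactly one of
`y, α y` lies in the cyclic interval `{x + k : 1 ≤ k ≤ m − 1}`. -/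
def Interlaces (n : ℕ) (α : Equiv.Perm (ZMod (2 * n))) (x y : ZMod (2 * n)) : Prop :=
  Xor' (0 < (y - x).val ∧ (y - x).val < (α x - x).val)
       (0 < (α y - x).val ∧ (α y - x).val < (α x - x).val)

/-- The interlacement graph of `α`: vertices are the chords, adjacency is interlacement. -/
def interGraph (n : ℕ) (α : Equiv.Perm (ZMod (2 * n))) :
    SimpleGraph {p : Sym2 (ZMod (2 * n)) // ∃ x, p = s(x, α x)} :=
  SimpleGraph.fromRel (fun c d => ∃ x y, c.1 = s(x, α x) ∧ d.1 = s(y, α y) ∧ Interlaces n α x y)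

/-- The partial-dual genus polynomial `∂Γ_α(z) = Σ_{A ⊆ chords} z^{g(α,A)}`, the sum running
over the α-invariant endpoint sets. -/
noncomputable def pdPoly (n : ℕ) (hn : n ≠ 0) (α : Equiv.Perm (ZMod (2 * n))) : Polynomial ℕ :=
  haveI : NeZero (2 * n) := ⟨by omega⟩
  ∑ S : Finset (ZMod (2 * n)),
    if (∀ x ∈ S, α x ∈ S) then Polynomial.X ^ pdGenus n α (↑S) else 0

/-- The face permutation `ρ ∘ α : x ↦ α x + 1`, whose orbits are the faces of the
one-vertex ribbon graph of `α`. -/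
def faceMap (n : ℕ) (α : Equiv.Perm (ZMod (2 * n))) : Equiv.Perm (ZMod (2 * n)) :=
  α.trans (Equiv.addRight 1)

/-- The face (orbit of `ρ ∘ α`) containing a point `z`. -/
def faceOrbit (n : ℕ) (α : Equiv.Perm (ZMod (2 * n))) (z : ZMod (2 * n)) : Set (ZMod (2 * n)) :=
  {w | (faceMap n α).SameCycle z w}

/-- The number of faces of the one-vertex ribbon graph of `α`:
the number of orbits of `ρ ∘ α`. -/
noncomputable def numFaces (n : ℕ) (α : Equiv.Perm (ZMod (2 * n))) : ℕ :=
  (Set.range (faceOrbit n α)).ncard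

/-- The chord diagram `B_n`: the involution `x ↦ x + n` of `ZMod (2n)`, all of whose
chords are pairwise interlacing. -/
def bn (n : ℕ) : Equiv.Perm (ZMod (2 * n)) :=
  Equiv.addRight (n : ZMod (2 * n))

lemma aux_firstAfter_eq (n : ℕ) (S : Set (ZMod (2 * n))) (y : ZMod (2 * n)) (k : ℕ) (hk : 0 < k)
    (hS : y + (k : ZMod (2 * n)) ∈ S) (hmin : ∀ j : ℕ, 0 < j → j < k → y + (j : ZMod (2 * n)) ∉ S) :
    firstAfter n S y = y + (k : ZMod (2 * n)) := by
  have h : ∃ k : ℕ, 0 < k ∧ y + (k : ZMod (2 * n)) ∈ S := ⟨k, hk, hS⟩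
  have hf : Nat.find h = k := by
    rw [Nat.find_eq_iff]
    refine ⟨⟨hk, hS⟩, ?_⟩
    rintro j hj ⟨h0, h1⟩
    exact hmin j h0 hj h1
  unfold firstAfter
  rw [dif_pos h, hf]

lemma aux_firstAfter_spec (n : ℕ) (S : Set (ZMod (2 * n))) (y : ZMod (2 * n))
    (h : ∃ k : ℕ, 0 < k ∧ y + (k : ZMod (2 * n)) ∈ S) :
    ∃ k : ℕ, 0 < k ∧ y + (k : ZMod (2 * n)) ∈ S ∧
      (∀ j : ℕ, 0 < j → j < k → y + (j : ZMod (2 * n)) ∉ S) ∧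
      firstAfter n S y = y + (k : ZMod (2 * n)) := by
  have hs := Nat.find_spec h
  have hm : ∀ j : ℕ, 0 < j → j < Nat.find h → y + (j : ZMod (2 * n)) ∉ S :=
    fun j hj hj' hS => Nat.find_min h hj' ⟨hj, hS⟩
  exact ⟨Nat.find h, hs.1, hs.2, hm, aux_firstAfter_eq n S y _ hs.1 hs.2 hm⟩

lemma aux_orbit_ge {β : Type*} (n : ℕ) (hn : 1 ≤ n) (α : Equiv.Perm (ZMod (2 * n)))
    (S : Set (ZMod (2 * n))) (hS : S.Nonempty) (L : ZMod (2 * n) → β)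
    (hL : ∀ u v, boundaryStep n α S u v → L u = L v) :
    (L '' S).ncard ≤ orbitCount n α S := by
  have : NeZero (2 * n) := ⟨by omega⟩
  have hL' : ∀ u v, Relation.EqvGen (boundaryStep n α S) u v → L u = L v := by
    intro u v h
    induction h with
    | rel _ _ h => exact hL _ _ h
    | refl => rfl
    | symm _ _ _ ih => exact ih.symm
    | trans _ _ _ _ _ ih1 ih2 => exact ih1.trans ih2
  obtain ⟨s, hs⟩ := hS
  unfold orbitCount
  rw [if_neg (Set.nonempty_iff_ne_empty.1 ⟨s, hs⟩)]
  let g : Set (ZMod (2 * n)) → β := fun C => if h : C.Nonempty then L h.some else L s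
  have hg : ∀ z, g {y | Relation.EqvGen (boundaryStep n α S) z y} = L z := by
    intro z
    have h : ({y | Relation.EqvGen (boundaryStep n α S) z y} : Set _).Nonempty :=
      ⟨z, Relation.EqvGen.refl z⟩
    simp only [g]
    rw [dif_pos h]
    exact (hL' _ _ h.some_mem).symm
  have : L '' S = g '' ((fun x => {y | Relation.EqvGen (boundaryStep n α S) x y}) '' S) := by
    rw [Set.image_image]
    simp only [hg]
  rw [this]
  exact Set.ncard_image_le (Set.toFinite _)

lemma aux_cast_inj (N : ℕ) (i j : ℕ) (hi : i < N) (hj : j < N)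
    (h : (i : ZMod N) = j) : i = j := by
  have := congrArg ZMod.val h
  rwa [ZMod.val_natCast_of_lt hi, ZMod.val_natCast_of_lt hj] at this

lemma aux_three (n : ℕ) (hn : 1 ≤ n) (α : Equiv.Perm (ZMod (2 * n)))
    (x : ZMod (2 * n)) (a b c : ℕ) (ha : 0 < a) (hab : a < b) (hbc : b < c) (hc : c < 2 * n)
    (h0 : α x = x + a) (h1 : α (x + a) = x) (h2 : α (x + b) = x + c) (h3 : α (x + c) = x + b) :
    3 ≤ orbitCount n α {x, x + (a : ZMod (2 * n)), x + (b : ZMod (2 * n)), x + (c : ZMod (2 * n))} := by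
  set S : Set (ZMod (2 * n)) :=
    {x, x + (a : ZMod (2 * n)), x + (b : ZMod (2 * n)), x + (c : ZMod (2 * n))} with hSdef
  have mem : ∀ j : ℕ, j < 2 * n → x + (j : ZMod (2 * n)) ∈ S → j = 0 ∨ j = a ∨ j = b ∨ j = c := by
    intro j hj h
    simp only [hSdef, Set.mem_insert_iff, Set.mem_singleton_iff, add_right_inj] at h
    rcases h with h | h | h | h
    · left
      apply aux_cast_inj (2 * n) j 0 hj (by omega)
      simpa using h
    · right; left; exact aux_cast_inj (2 * n) _ _ hj (by omega) h
    · right; right; left; exact aux_cast_inj (2 * n) _ _ hj (by omega) h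
    · right; right; right; exact aux_cast_inj (2 * n) _ _ hj (by omega) h
  have fa : ∀ i k : ℕ, i < k → k ≤ 2 * n → x + (k : ZMod (2 * n)) ∈ S →
      (∀ j, i < j → j < k → j ≠ 0 ∧ j ≠ a ∧ j ≠ b ∧ j ≠ c) →
      firstAfter n S (x + i) = x + k := by
    intro i k hik hk hkS hj
    rw [aux_firstAfter_eq n S (x + i) (k - i) (by omega)]
    · rw [add_assoc, ← Nat.cast_add]; congr 2; omega
    · rw [add_assoc, ← Nat.cast_add, show i + (k - i) = k by omega]; exact hkS
    · intro j hj0 hjk hm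
      rw [add_assoc, ← Nat.cast_add] at hm
      have := mem (i + j) (by omega) hm
      have := hj (i + j) (by omega) (by omega)
      omega
  have f0 : firstAfter n S x = x + a := by
    have := fa 0 a ha (by omega) (by simp [hSdef]) (by intros; omega)
    simpa using this
  have f1 : firstAfter n S (x + a) = x + b :=
    fa a b hab (by omega) (by simp [hSdef]) (by intros; omega)
  have f2 : firstAfter n S (x + b) = x + c :=
    fa b c hbc (by omega) (by simp [hSdef]) (by intros; omega)
  have f3 : firstAfter n S (x + c) = x := by
    have h := fa c (2 * n) hc le_rfl (by rw [ZMod.natCast_self]; simp [hSdef]) (by intros; omega)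
    rwa [ZMod.natCast_self, add_zero] at h
  have e : ∀ i j : ℕ, i < 2 * n → j < 2 * n → i ≠ j →
      x + (i : ZMod (2 * n)) ≠ x + (j : ZMod (2 * n)) := by
    intro i j hi hj hij h
    exact hij (aux_cast_inj (2 * n) i j hi hj (add_left_cancel h))
  have e0a := e 0 a (by omega) (by omega) (by omega)
  have e0c := e 0 c (by omega) (by omega) (by omega)
  have eba := e b a (by omega) (by omega) (by omega)
  have ebc := e b c (by omega) (by omega) (by omega)
  have eca := e c a (by omega) (by omega) (by omega)
  simp only [Nat.cast_zero, add_zero] at e0a e0c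
  let L : ZMod (2 * n) → ℕ := fun z => if z = x + a then 1 else if z = x + c then 2 else 0
  have L0 : L x = 0 := by simp only [L]; rw [if_neg e0a, if_neg e0c]
  have La : L (x + a) = 1 := if_pos rfl
  have Lb : L (x + b) = 0 := by simp only [L]; rw [if_neg eba, if_neg ebc]
  have Lc : L (x + c) = 2 := by simp only [L]; rw [if_neg eca]; simp
  have key := aux_orbit_ge n hn α S ⟨x, by simp [hSdef]⟩ L (by
    rintro u v ⟨hu, rfl⟩
    simp only [hSdef, Set.mem_insert_iff, Set.mem_singleton_iff] at hu
    rcases hu with rfl | rfl | rfl | rfl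
    · rw [h0, f1, L0, Lb]
    · rw [h1, f0]
    · rw [h2, f3, L0, Lb]
    · rw [h3, f2])
  have : L '' S = {0, 1, 0, 2} := by
    simp only [hSdef, Set.image_insert_eq, Set.image_singleton, L0, La, Lb, Lc]
  rw [this] at key
  have h3 : ({0, 1, 0, 2} : Set ℕ) = (({0, 1, 2} : Finset ℕ) : Set ℕ) := by
    ext z; simp; tauto
  rw [h3, Set.ncard_coe_finset] at key
  simpa using key

lemma aux_three' (n : ℕ) (hn : 1 ≤ n) (α : Equiv.Perm (ZMod (2 * n)))
    (hinv : ∀ x, α (α x) = x) (hfree : ∀ x, α x ≠ x)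
    (x y : ZMod (2 * n)) (hdistinct : y ≠ x ∧ y ≠ α x)
    (hnotint : ¬ Interlaces n α x y) :
    3 ≤ orbitCount n α {x, α x, y, α y} := by
  have : NeZero (2 * n) := ⟨by omega⟩
  have hz : ∀ z, z = x + (((z - x).val : ℕ) : ZMod (2 * n)) := by
    intro z; rw [ZMod.natCast_zmod_val]; ring
  have hinj : ∀ z w : ZMod (2 * n), z ≠ w → (z - x).val ≠ (w - x).val := by
    intro z w h h'
    exact h (by rw [hz z, hz w, h'])
  have hx0 : (x - x).val = 0 := by simp
  have d1 := hinj _ _ (hfree x)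
  have d2 := hinj _ _ hdistinct.1
  have d3 := hinj _ _ hdistinct.2
  have d4 := hinj (α y) x (by intro h; apply hdistinct.2; rw [← h, hinv])
  have d5 := hinj (α y) (α x) (by intro h; exact hdistinct.1 (α.injective h))
  have d6 := hinj _ _ (hfree y)
  have p1 := ZMod.val_lt (α x - x)
  have p2 := ZMod.val_lt (y - x)
  have p3 := ZMod.val_lt (α y - x)
  have hp := hz (α x)
  have hq := hz y
  have hr := hz (α y)
  unfold Interlaces at hnotint
  rw [hx0] at d1 d2 d4
  generalize (α x - x).val = p at *
  generalize (y - x).val = q at *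
  generalize (α y - x).val = r at *
  have hcase : (p < q ∧ p < r) ∨ (q < p ∧ r < p) := by
    by_contra hcon
    apply hnotint
    unfold Xor' Xor
    omega
  have hc0 : ((2 * n - p : ℕ) : ZMod (2 * n)) = - (p : ZMod (2 * n)) := by
    rw [Nat.cast_sub p1.le, ZMod.natCast_self, zero_sub]
  rcases hcase with ⟨h1, h2⟩ | ⟨h1, h2⟩
  · rcases lt_or_gt_of_ne d6 with h | h
    · have := aux_three n hn α x p r q (by omega) h2 h p2 hp (by rw [← hp, hinv])
        (by rw [← hr, ← hq, hinv]) (by rw [← hr, ← hq])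
      rw [← hp, ← hr, ← hq] at this
      rwa [Set.pair_comm y]
    · have := aux_three n hn α x p q r (by omega) h1 h p3 hp (by rw [← hp, hinv])
        (by rw [← hr, ← hq]) (by rw [← hr, ← hq, hinv])
      rwa [← hp, ← hr, ← hq] at this
  · have ex : x = α x + ((2 * n - p : ℕ) : ZMod (2 * n)) := by
      rw [hc0, hp]; ring
    have ey : y = α x + ((2 * n - p + q : ℕ) : ZMod (2 * n)) := by
      rw [Nat.cast_add, hc0, hp, hq]; ring
    have er : α y = α x + ((2 * n - p + r : ℕ) : ZMod (2 * n)) := by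
      rw [Nat.cast_add, hc0, hp, hr]; ring
    rw [Set.insert_comm]
    rcases lt_or_gt_of_ne d6 with h | h
    · have := aux_three n hn α (α x) (2 * n - p) (2 * n - p + r) (2 * n - p + q) (by omega)
        (by omega) (by omega) (by omega) (by rw [← ex, hinv]) (by rw [← ex])
        (by rw [← er, ← ey, hinv]) (by rw [← er, ← ey])
      rw [← ex, ← er, ← ey] at this
      rwa [Set.pair_comm y]
    · have := aux_three n hn α (α x) (2 * n - p) (2 * n - p + q) (2 * n - p + r) (by omega)
        (by omega) (by omega) (by omega) (by rw [← ex, hinv]) (by rw [← ex])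
        (by rw [← er, ← ey]) (by rw [← er, ← ey, hinv])
      rwa [← ex, ← er, ← ey] at this

lemma aux_faceOrbit_eq (n : ℕ) (α : Equiv.Perm (ZMod (2 * n))) (u v : ZMod (2 * n)) :
    faceOrbit n α u = faceOrbit n α v ↔ (faceMap n α).SameCycle u v := by
  constructor
  · intro h
    have : v ∈ faceOrbit n α u := by
      rw [h]; exact Equiv.Perm.SameCycle.refl _ _
    exact this
  · intro h
    ext w
    exact ⟨fun hw => h.symm.trans hw, fun hw => h.trans hw⟩

lemma aux_univ (n : ℕ) (hn : 1 ≤ n) (α : Equiv.Perm (ZMod (2 * n))) :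
    orbitCount n α Set.univ = numFaces n α := by
  have : NeZero (2 * n) := ⟨by omega⟩
  have hfa : ∀ u, firstAfter n Set.univ u = u + 1 := by
    intro u
    rw [aux_firstAfter_eq n Set.univ u 1 one_pos (Set.mem_univ _) (by intros; omega)]
    simp
  have hst : ∀ u v, boundaryStep n α Set.univ u v ↔ v = faceMap n α u := by
    intro u v
    simp [boundaryStep, hfa, faceMap]
  have : ∀ u v, Relation.EqvGen (boundaryStep n α Set.univ) u v ↔ (faceMap n α).SameCycle u v := by
    intro u v
    constructor
    · intro h
      induction h with
      | rel a b h => rw [(hst a b).1 h]; exact (Equiv.Perm.SameCycle.refl _ _).apply_right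
      | refl => exact Equiv.Perm.SameCycle.refl _ _
      | symm _ _ _ ih => exact ih.symm
      | trans _ _ _ _ _ ih1 ih2 => exact ih1.trans ih2
    · intro h
      obtain ⟨i, hi, rfl⟩ := h.exists_pow_eq'
      clear h hi
      induction i with
      | zero => exact Relation.EqvGen.refl _
      | succ k ih =>
        rw [pow_succ', Equiv.Perm.mul_apply]
        exact ih.trans _ _ _ (Relation.EqvGen.rel _ _ ((hst _ _).2 rfl))
  unfold orbitCount numFaces
  rw [if_neg (by simp), Set.image_univ]
  congr 2
  funext u
  ext v
  exact this u v

lemma aux_compl (n : ℕ) (hn : 1 ≤ n) (α : Equiv.Perm (ZMod (2 * n)))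
    (hinv : ∀ x, α (α x) = x) (x : ZMod (2 * n)) (S : Set (ZMod (2 * n))) (hxS : x ∈ S)
    (hS : ∀ z ∈ S, α z ∈ S) (F1 F2 : Set (ZMod (2 * n)))
    (hF : ∀ z ∈ S, faceOrbit n α z = F1 ∨ faceOrbit n α z = F2) :
    numFaces n α ≤ orbitCount n α Sᶜ + 1 := by
  have : NeZero (2 * n) := ⟨by omega⟩
  have hstep : ∀ z, faceOrbit n α (faceMap n α z) = faceOrbit n α z := by
    intro z
    rw [aux_faceOrbit_eq]
    exact (Equiv.Perm.SameCycle.refl _ _).apply_left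
  have hT : ∀ z ∈ Sᶜ, α z ∈ Sᶜ := by
    intro z hz h
    exact hz (by have := hS _ h; rwa [hinv] at this)
  have hpair : ({F1, F2} : Set (Set (ZMod (2 * n)))).ncard ≤ 2 := by
    apply (Set.ncard_insert_le _ _).trans; simp
  by_cases hex : ∃ t ∈ Sᶜ, faceOrbit n α t = F1 ∨ faceOrbit n α t = F2
  · obtain ⟨t, htS, ht⟩ := hex
    let L : ZMod (2 * n) → Set (ZMod (2 * n)) := fun z =>
      if faceOrbit n α z = F1 ∨ faceOrbit n α z = F2 then ∅ else faceOrbit n α z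
    have hLst : ∀ z, L (faceMap n α z) = L z := by
      intro z; simp only [L, hstep]
    have hLS : ∀ z ∈ S, L z = ∅ := by
      intro z hz; simp only [L]; rw [if_pos (hF z hz)]
    have key := aux_orbit_ge n hn α Sᶜ ⟨t, htS⟩ L (by
      rintro u v ⟨hu, rfl⟩
      have hau := hT u hu
      have hexk : ∃ k : ℕ, 0 < k ∧ α u + (k : ZMod (2 * n)) ∈ Sᶜ :=
        ⟨2 * n, by omega, by rwa [ZMod.natCast_self, add_zero]⟩
      by_cases h1 : α u + 1 ∈ Sᶜ
      · rw [aux_firstAfter_eq n Sᶜ (α u) 1 one_pos (by simpa using h1) (by intros; omega)]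
        have := hLst u
        simp only [faceMap, Equiv.trans_apply, Equiv.coe_addRight] at this
        rw [Nat.cast_one, this]
      · have hLu : L u = ∅ := by
          rw [← hLst u]
          apply hLS
          by_contra h
          exact h1 h
        rw [hLu]
        obtain ⟨k, hk0, hkT, hmin, hfe⟩ := aux_firstAfter_spec n Sᶜ (α u) hexk
        rw [hfe]
        have hmin : ∀ j : ℕ, 0 < j → j < k → α u + (j : ZMod (2 * n)) ∈ S := by
          intro j hj hj'
          by_contra h
          exact hmin j hj hj' h
        have hne : k ≠ 1 := by
          rintro rfl
          exact h1 (by simpa using hkT)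
        have hw := hS _ (hmin (k - 1) (by omega) (by omega))
        have := hLst (α (α u + ((k - 1 : ℕ) : ZMod (2 * n))))
        rw [hLS _ hw] at this
        simp only [faceMap, Equiv.trans_apply, Equiv.coe_addRight, hinv] at this
        rw [← this]
        congr 1
        rw [add_assoc, ← Nat.cast_add_one, Nat.sub_add_cancel hk0])
    have hsub : Set.range (faceOrbit n α) ⊆ {F1, F2} ∪ ((L '' Sᶜ) \ {∅}) := by
      rintro _ ⟨z, rfl⟩
      by_cases hz : faceOrbit n α z = F1 ∨ faceOrbit n α z = F2
      · left; simpa using hz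
      · right
        refine ⟨⟨z, fun h => hz (hF z h), ?_⟩, ?_⟩
        · simp only [L]; rw [if_neg hz]
        · intro h
          have hh : z ∈ faceOrbit n α z := Equiv.Perm.SameCycle.refl _ _
          rw [Set.mem_singleton_iff.1 h] at hh
          exact hh
    have hmem : (∅ : Set (ZMod (2 * n))) ∈ L '' Sᶜ := ⟨t, htS, by simp only [L]; rw [if_pos ht]⟩
    have h1 := Set.ncard_le_ncard hsub (Set.toFinite _)
    have h2 := Set.ncard_union_le ({F1, F2} : Set (Set (ZMod (2 * n)))) ((L '' Sᶜ) \ {∅})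
    have h3 := Set.ncard_sdiff_singleton_add_one hmem (Set.toFinite _)
    unfold numFaces
    omega
  · push Not at hex
    have hall : ∀ z ∈ S, z + 1 ∈ S := by
      intro z hz
      by_contra h
      have h1 := hF _ (hS z hz)
      have h2 := hex _ h
      have h3 := hstep (α z)
      simp only [faceMap, Equiv.trans_apply, Equiv.coe_addRight, hinv] at h3
      rw [h3] at h2
      tauto
    have hall' : ∀ k : ℕ, x + (k : ZMod (2 * n)) ∈ S := by
      intro k
      induction k with
      | zero => simpa using hxS
      | succ k ih => rw [Nat.cast_add_one, ← add_assoc]; exact hall _ ih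
    have hSu : ∀ z, z ∈ S := by
      intro z
      have := hall' (z - x).val
      rw [ZMod.natCast_zmod_val] at this
      simpa using this
    have hSc : Sᶜ = ∅ := by
      ext z; simp [hSu z]
    have hsub : Set.range (faceOrbit n α) ⊆ {F1, F2} := by
      rintro _ ⟨z, rfl⟩
      simpa using hF z (hSu z)
    have h1 := Set.ncard_le_ncard hsub (Set.toFinite _)
    unfold numFaces orbitCount
    rw [if_pos hSc]
    omega

lemma aux_not_int (n : ℕ) (hn : 1 ≤ n) (α : Equiv.Perm (ZMod (2 * n)))
    (hinv : ∀ x, α (α x) = x) (z : ZMod (2 * n)) (hz : α z + 1 = z) (u v : ZMod (2 * n))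
    (hu : u = z ∨ u = α z) (hv : v ≠ z ∧ v ≠ α z) :
    ¬ Interlaces n α u v ∧ ¬ Interlaces n α v u := by
  have : NeZero (2 * n) := ⟨by omega⟩
  have : Fact (1 < 2 * n) := ⟨by omega⟩
  have hav : α v ≠ z ∧ α v ≠ α z :=
    ⟨fun h => hv.2 (by rw [← h, hinv]), fun h => hv.1 (α.injective h)⟩
  have hpos : ∀ a b : ZMod (2 * n), a ≠ b → 0 < (a - b).val := by
    intro a b h
    rw [Nat.pos_iff_ne_zero]
    intro h'
    rw [ZMod.val_eq_zero, sub_eq_zero] at h'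
    exact h h'
  -- the predecessor of `z` relative to a base point
  have hpred : ∀ w : ZMod (2 * n), w ≠ z → (z - w).val = (α z - w).val + 1 := by
    intro w hw
    have h1 : z - w = (α z - w) + 1 := by nth_rewrite 1 [← hz]; ring
    have hlt : (α z - w).val + 1 < 2 * n := by
      have h2 := ZMod.val_lt (α z - w)
      by_contra hcon
      have h3 : (α z - w).val + 1 = 2 * n := by omega
      have h4 : ((((α z - w).val + 1 : ℕ)) : ZMod (2 * n)) = 0 := by
        rw [h3, ZMod.natCast_self]
      rw [Nat.cast_add_one, ZMod.natCast_zmod_val, ← h1, sub_eq_zero] at h4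
      exact hw h4.symm
    rw [h1, ZMod.val_add_of_lt]
    · rw [ZMod.val_one]
    · rw [ZMod.val_one]; exact hlt
  have hB : ¬ Interlaces n α v z ∧ ¬ Interlaces n α v (α z) := by
    have h1 := hpred v hv.1
    have h2 := hpos (α z) v hv.2.symm
    have h3 : (α v - v).val ≠ (z - v).val := by
      intro h
      exact hav.1 (sub_left_injective (ZMod.val_injective _ h))
    unfold Interlaces Xor' Xor
    rw [hinv]
    omega
  have hA : ¬ Interlaces n α z v ∧ ¬ Interlaces n α (α z) v := by
    have g1 := hpos v (α z) hv.2
    have g2 := hpos (α v) (α z) hav.2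
    have hm1 : α z - z = -1 := by
      nth_rewrite 2 [← hz]; ring
    have hm : (z - α z).val = 1 := by
      have : z - α z = 1 := by rw [← neg_sub, hm1, neg_neg]
      rw [this, ZMod.val_one]
    have hm2 : (α z - z).val + 1 = 2 * n := by
      have h := ZMod.val_add_val_of_le (a := α z - z) (b := 1)
      have : (α z - z).val = 2 * n - 1 := by
        rw [hm1, ZMod.neg_val, if_neg one_ne_zero, ZMod.val_one]
      omega
    have k1 := hpos v z hv.1
    have k2 := hpos (α v) z hav.1
    have l1 := ZMod.val_lt (v - z)
    have l2 := ZMod.val_lt (α v - z)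
    have n1 : (v - z).val ≠ (α z - z).val := fun h =>
      hv.2 (sub_left_injective (ZMod.val_injective _ h))
    have n2 : (α v - z).val ≠ (α z - z).val := fun h =>
      hav.2 (sub_left_injective (ZMod.val_injective _ h))
    unfold Interlaces Xor' Xor
    rw [hinv]
    omega
  rcases hu with rfl | rfl
  · exact ⟨hA.1, hB.1⟩
  · exact ⟨hA.2, hB.2⟩

lemma aux_no_fixed (n : ℕ) (hn : 1 ≤ n) (α : Equiv.Perm (ZMod (2 * n)))
    (hinv : ∀ x, α (α x) = x)
    (hconn : (interGraph n α).Connected)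
    (x y : ZMod (2 * n)) (hdistinct : y ≠ x ∧ y ≠ α x) (z : ZMod (2 * n)) :
    faceMap n α z ≠ z := by
  intro hz
  have hz' : α z + 1 = z := by simpa [faceMap] using hz
  have hne : ∀ u v : ZMod (2 * n), s(u, α u) ≠ s(v, α v) → u ≠ v ∧ u ≠ α v := by
    intro u v h
    constructor
    · rintro rfl; exact h rfl
    · rintro rfl; apply h; rw [hinv, Sym2.eq_swap]
  let V := {p : Sym2 (ZMod (2 * n)) // ∃ x, p = s(x, α x)}
  let cx : V := ⟨s(x, α x), x, rfl⟩
  let cy : V := ⟨s(y, α y), y, rfl⟩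
  let cz : V := ⟨s(z, α z), z, rfl⟩
  have hxy : cx ≠ cy := by
    intro h
    have h := congrArg Subtype.val h
    simp only [cx, cy, Sym2.eq_iff] at h
    rcases h with h | h
    · exact hdistinct.1 h.1.symm
    · exact hdistinct.2 h.2.symm
  have : Nontrivial V := ⟨cx, cy, hxy⟩
  obtain ⟨d, hd⟩ := hconn.preconnected.exists_adj_of_nontrivial cz
  unfold interGraph at hd
  rw [SimpleGraph.fromRel_adj] at hd
  obtain ⟨hne1, hd⟩ := hd
  have hrep : ∀ u, cz.1 = s(u, α u) → u = z ∨ u = α z := by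
    intro u hu
    simp only [cz, Sym2.eq_iff] at hu
    rcases hu with h | h
    · exact Or.inl h.1.symm
    · exact Or.inr h.2.symm
  have hrep2 : ∀ v, d.1 = s(v, α v) → v ≠ z ∧ v ≠ α z := by
    intro v hv
    apply hne
    intro h
    exact hne1 (Subtype.ext (by rw [hv, h]))
  rcases hd with ⟨u, v, h1, h2, h3⟩ | ⟨v, u, h2, h1, h3⟩
  · exact (aux_not_int n hn α hinv z hz' u v (hrep u h1) (hrep2 v h2)).1 h3
  · exact (aux_not_int n hn α hinv z hz' u v (hrep u h1) (hrep2 v h2)).2 h3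

lemma aux_sign_rot (N : ℕ) [NeZero N] :
    Equiv.Perm.sign (Equiv.addRight (1 : ZMod N)) = (-1) ^ (N - 1) := by
  obtain _ | m := N
  · exact absurd rfl (NeZero.ne 0)
  · rw [← sign_finRotate (m + 1)]
    refine Equiv.Perm.sign_eq_sign_of_equiv _ _ (Equiv.refl (Fin (m + 1))) ?_
    intro i
    exact (finRotate_apply (n := m + 1) i).symm

lemma aux_faces (n : ℕ) (hn : 1 ≤ n) (α : Equiv.Perm (ZMod (2 * n)))
    (hinv : ∀ x, α (α x) = x) (hfree : ∀ x, α x ≠ x)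
    (hfix : ∀ z, faceMap n α z ≠ z) :
    numFaces n α ≤ n ∧ Even (numFaces n α + n + 1) := by
  have : NeZero (2 * n) := ⟨by omega⟩
  set f := faceMap n α with hf
  have hcard : f.cycleType.card = numFaces n α := by
    unfold numFaces
    have : Set.range (faceOrbit n α) =
        (fun c : Equiv.Perm (ZMod (2 * n)) => (c.support : Set (ZMod (2 * n)))) ''
          (f.cycleFactorsFinset : Set (Equiv.Perm (ZMod (2 * n)))) := by
      have hor : ∀ z, faceOrbit n α z = ((f.cycleOf z).support : Set _) := by
        intro z
        ext w
        simp only [Finset.mem_coe]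
        rw [Equiv.Perm.mem_support_cycleOf_iff' (hfix z)]
        rfl
      ext C
      constructor
      · rintro ⟨z, rfl⟩
        refine ⟨f.cycleOf z, ?_, (hor z).symm⟩
        rw [Finset.mem_coe, Equiv.Perm.cycleOf_mem_cycleFactorsFinset_iff,
          Equiv.Perm.mem_support]
        exact hfix z
      · rintro ⟨c, hc, rfl⟩
        have hc' := Finset.mem_coe.1 hc
        obtain ⟨a, ha⟩ := (Equiv.Perm.mem_cycleFactorsFinset_iff.1 hc').1.nonempty_support
        refine ⟨a, ?_⟩
        rw [hor, Equiv.Perm.cycle_is_cycleOf ha hc']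
    rw [this, Set.ncard_image_of_injOn, Set.ncard_coe_finset]
    · simp [Equiv.Perm.cycleType]
    · intro c hc d hd hcd
      have hc' := Finset.mem_coe.1 hc
      have hd' := Finset.mem_coe.1 hd
      obtain ⟨a, ha⟩ := (Equiv.Perm.mem_cycleFactorsFinset_iff.1 hc').1.nonempty_support
      have ha' : a ∈ d.support := by
        have : c.support = d.support := Finset.coe_injective hcd
        rwa [← this]
      rw [Equiv.Perm.cycle_is_cycleOf ha hc', Equiv.Perm.cycle_is_cycleOf ha' hd']
  have hsum : f.cycleType.sum = 2 * n := by
    rw [Equiv.Perm.sum_cycleType]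
    have : f.support = Finset.univ := by
      ext z; simp [hfix z]
    rw [this, Finset.card_univ, ZMod.card]
  have hle : f.cycleType.card * 2 ≤ f.cycleType.sum := by
    have := Multiset.card_nsmul_le_sum (s := f.cycleType) (a := 2)
      (fun k hk => Equiv.Perm.two_le_of_mem_cycleType hk)
    simpa using this
  refine ⟨by omega, ?_⟩
  have hs := Equiv.Perm.sign_of_cycleType f
  rw [hsum, hcard] at hs
  have hs2 : Equiv.Perm.sign f = (-1) ^ (2 * n - 1) * (-1) ^ n := by
    have : f = Equiv.addRight (1 : ZMod (2 * n)) * α := rfl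
    rw [this, Equiv.Perm.sign_mul, aux_sign_rot]
    congr 1
    have h2 : α ^ 2 = 1 := by
      ext z; simp [pow_two, hinv]
    rw [Equiv.Perm.sign_of_pow_two_eq_one h2]
    have : IsEmpty (Function.fixedPoints α) := ⟨fun z => hfree z.1 z.2⟩
    rw [Fintype.card_eq_zero (α := Function.fixedPoints α), ZMod.card]
    congr 1
    omega
  rw [hs2, ← pow_add] at hs
  have h1 : ((-1 : ℤˣ)) ^ (2 * n - 1 + n + (2 * n + numFaces n α)) = 1 := by
    rw [pow_add, hs, ← pow_add, ← two_mul, pow_mul]; simp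
  rw [neg_one_pow_eq_one_iff_even (by decide)] at h1
  rw [Nat.even_iff] at h1 ⊢
  omega

/-- **Lemma, part (3)**: under the same hypotheses, any chord not interlaced with the chord
`{x, α x}` is attached to a pair of face-discs (orbits of `ρ ∘ α`) different from the pair
attached to `{x, α x}`. -/
theorem noninterlaced_different_faces (n : ℕ) (hn : 1 ≤ n) (α : Equiv.Perm (ZMod (2 * n)))
    (hinv : ∀ x, α (α x) = x) (hfree : ∀ x, α x ≠ x)
    (hconn : (interGraph n α).Connected)
    (hgenus : ∀ S : Set (ZMod (2 * n)), (∀ x ∈ S, α x ∈ S) →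
      pdGenus n α S = pdGenus n α ∅)
    (x y : ZMod (2 * n)) (hdistinct : y ≠ x ∧ y ≠ α x)
    (hnotint : ¬ Interlaces n α x y) :
    ({faceOrbit n α y, faceOrbit n α (α y)} : Set (Set (ZMod (2 * n)))) ≠
      {faceOrbit n α x, faceOrbit n α (α x)} := by
  have : NeZero (2 * n) := ⟨by omega⟩
  intro hpair
  have hfix := aux_no_fixed n hn α hinv hconn x y hdistinct
  obtain ⟨hle, hev⟩ := aux_faces n hn α hinv hfree hfix
  have h3 := aux_three' n hn α hinv hfree x y hdistinct hnotint
  have hS : ∀ z ∈ ({x, α x, y, α y} : Set (ZMod (2 * n))),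
      α z ∈ ({x, α x, y, α y} : Set (ZMod (2 * n))) := by
    rintro z (rfl | rfl | rfl | rfl) <;> simp [hinv]
  have hy1 : faceOrbit n α y ∈
      ({faceOrbit n α x, faceOrbit n α (α x)} : Set (Set (ZMod (2 * n)))) := by
    rw [← hpair]; simp
  have hy2 : faceOrbit n α (α y) ∈
      ({faceOrbit n α x, faceOrbit n α (α x)} : Set (Set (ZMod (2 * n)))) := by
    rw [← hpair]; simp
  have hc := aux_compl n hn α hinv x {x, α x, y, α y} (by simp) hS
    (faceOrbit n α x) (faceOrbit n α (α x)) (by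
      rintro z (rfl | rfl | rfl | rfl)
      · exact Or.inl rfl
      · exact Or.inr rfl
      · simpa using hy1
      · simpa using hy2)
  have hg := hgenus _ hS
  have h0 : orbitCount n α ∅ = 1 := by unfold orbitCount; rw [if_pos rfl]
  unfold pdGenus at hg
  rw [Set.compl_empty, aux_univ n hn α, h0] at hg
  rw [Nat.even_iff] at hev
  omega
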